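/- arXiv:1603.07779 — 2 statements merged into one kernel-verified Lean document; each statement's English description precedes it below -/
import Mathlib

section
/- There exists a constant K such that for all sufficiently large n the following holds, where g is the confounding gadget on b = ⌈100 log₂ n⌉ bits: for every rectangle X×Y ⊆ ({0,1}^b)ⁿ × ({0,1}^b)ⁿ, every z ∈ {0,1}ⁿ, and every real c ≥ 0, if |(X×Y) ∩ W_z| ≥ 2^{-c}·|W_z|, then there exists a subcube Z ⊆ {0,1}ⁿ of codimension at most K·c/b such that for every z' ∈ Z there exists (x,y) ∈ X×Y with gⁿ(x,y) = z'. -/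
/-- The Hamming weight of `z ∈ {0,1}ⁿ`. -/
def hw {n : ℕ} (z : Fin n → Bool) : ℕ :=
  (Finset.univ.filter fun i => z i = true).card

/-- The partial function `f : {0,1}ⁿ → {0,1}` with `f z = 1` if `|z| = n/2` and
`f z = 0` if `|z| = 0` (undefined, i.e. `none`, elsewhere). -/
def fPartial (n : ℕ) (z : Fin n → Bool) : Option Bool :=
  if hw z = n / 2 then some true else if hw z = 0 then some false else none

/-- `gⁿ(x,y) = (g(x₁,y₁), …, g(xₙ,yₙ))`. -/
def gpow {b n : ℕ} (g : (Fin b → Bool) → (Fin b → Bool) → Bool)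
    (x y : Fin n → Fin b → Bool) : Fin n → Bool :=
  fun i => g (x i) (y i)

/-- The composed partial 0-1 matrix `f ∘ gⁿ`, with rows indexed by
`x ∈ ({0,1}^b)ⁿ` and columns by `y ∈ ({0,1}^b)ⁿ`; `none` denotes a `*` entry. -/
def composed (b n : ℕ) (g : (Fin b → Bool) → (Fin b → Bool) → Bool)
    (x y : Fin n → Fin b → Bool) : Option Bool :=
  fPartial n (gpow g x y)

/-- The inner product modulo 2 gadget on `b`-bit strings. -/
def IP (b : ℕ) (u v : Fin b → Bool) : Bool :=
  decide ((∑ i : Fin b, (u i).toNat * (v i).toNat) % 2 = 1)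

/-- The number of bits `b(n) = ⌈100 log₂ n⌉` of the confounding gadget. -/
noncomputable def bOf (n : ℕ) : ℕ := ⌈(100 : ℝ) * Real.logb 2 n⌉₊

/-- `W z = (gⁿ)⁻¹(z)` for the confounding gadget on `b(n)` bits, as a finset of pairs. -/
noncomputable def Wset (n : ℕ) (z : Fin n → Bool) :
    Finset ((Fin n → Fin (bOf n) → Bool) × (Fin n → Fin (bOf n) → Bool)) :=
  Finset.univ.filter fun p => gpow (IP (bOf n)) p.1 p.2 = z

/-- The sign `(-1)^t` of a bit. -/
def bitSign (t : Bool) : ℝ := if t then -1 else 1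

lemma abs_bitSign (t : Bool) : |bitSign t| = 1 := by
  cases t <;> simp [bitSign]

lemma IP_comm {b : ℕ} (u v : Fin b → Bool) : IP b u v = IP b v u := by
  simp only [IP, mul_comm]

lemma bitSign_IP {b : ℕ} (u v : Fin b → Bool) :
    bitSign (IP b u v) = ∏ j, bitSign (u j && v j) := by
  have h : ∀ m : ℕ, bitSign (decide (m % 2 = 1)) = (-1) ^ m := by
    intro m
    rcases Nat.even_or_odd m with hm | hm
    · simp [bitSign, hm.neg_one_pow, Nat.even_iff.mp hm]
    · simp [bitSign, hm.neg_one_pow, Nat.odd_iff.mp hm]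
  rw [IP, h, ← Finset.prod_pow_eq_pow_sum]
  refine Finset.prod_congr rfl fun j _ => ?_
  cases u j <;> cases v j <;> simp [bitSign]

lemma sum_bitSign_IP_mul {b : ℕ} (v w : Fin b → Bool) :
    ∑ u, bitSign (IP b u v) * bitSign (IP b u w) = if v = w then (2 : ℝ) ^ b else 0 := by
  simp only [bitSign_IP, ← Finset.prod_mul_distrib]
  rw [← Fintype.prod_sum (fun j (t : Bool) => bitSign (t && v j) * bitSign (t && w j))]
  have h : ∀ j, ∑ t : Bool, bitSign (t && v j) * bitSign (t && w j)
      = if v j = w j then (2 : ℝ) else 0 := by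
    intro j
    cases v j <;> cases w j <;> norm_num [bitSign]
  simp only [h]
  split_ifs with hvw
  · simp [hvw]
  · obtain ⟨j, hj⟩ := Function.ne_iff.mp hvw
    exact Finset.prod_eq_zero (Finset.mem_univ j) (if_neg hj)

/-- The character `(-1)^(∑ᵢ ⟨xᵢ, yᵢ⟩)`. -/
def ipChar {ι : Type*} [Fintype ι] {b : ℕ} (x y : ι → Fin b → Bool) : ℝ :=
  ∏ i, bitSign (IP b (x i) (y i))

lemma sum_ipChar_mul {ι : Type*} [Fintype ι] [DecidableEq ι] {b : ℕ} (y w : ι → Fin b → Bool) :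
    ∑ x, ipChar x y * ipChar x w = if y = w then ((2 : ℝ) ^ b) ^ Fintype.card ι else 0 := by
  simp only [ipChar, ← Finset.prod_mul_distrib]
  rw [← Fintype.prod_sum
    (fun i (u : Fin b → Bool) => bitSign (IP b u (y i)) * bitSign (IP b u (w i)))]
  simp only [sum_bitSign_IP_mul]
  split_ifs with h
  · simp [h]
  · obtain ⟨j, hj⟩ := Function.ne_iff.mp h
    exact Finset.prod_eq_zero (Finset.mem_univ j) (if_neg hj)

/-- Lindsey's inequality for the inner product matrix. -/
lemma sq_sum_mul_ipChar_le {ι : Type*} [Fintype ι] [DecidableEq ι] {b : ℕ}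
    (p q : (ι → Fin b → Bool) → ℝ) :
    (∑ x, ∑ y, p x * q y * ipChar x y) ^ 2 ≤
      ((2 : ℝ) ^ b) ^ Fintype.card ι * ((∑ x, p x ^ 2) * ∑ y, q y ^ 2) := by
  have hq : ∑ x, (∑ y, q y * ipChar x y) ^ 2 =
      ((2 : ℝ) ^ b) ^ Fintype.card ι * ∑ y, q y ^ 2 := by
    calc ∑ x, (∑ y, q y * ipChar x y) ^ 2
        = ∑ x, ∑ y, ∑ w, q y * q w * (ipChar x y * ipChar x w) := by
          refine Finset.sum_congr rfl fun x _ => ?_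
          rw [sq, Finset.sum_mul_sum]
          refine Finset.sum_congr rfl fun y _ => Finset.sum_congr rfl fun w _ => by ring
      _ = ∑ y, ∑ w, ∑ x, q y * q w * (ipChar x y * ipChar x w) := by
          rw [Finset.sum_comm]
          exact Finset.sum_congr rfl fun y _ => Finset.sum_comm
      _ = ((2 : ℝ) ^ b) ^ Fintype.card ι * ∑ y, q y ^ 2 := by
          simp only [← Finset.mul_sum, sum_ipChar_mul, mul_ite, mul_zero, Finset.sum_ite_eq,
            Finset.mem_univ, if_true]
          rw [Finset.mul_sum]
          exact Finset.sum_congr rfl fun y _ => by ring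
  calc (∑ x, ∑ y, p x * q y * ipChar x y) ^ 2
      = (∑ x, p x * ∑ y, q y * ipChar x y) ^ 2 := by
        simp only [Finset.mul_sum, mul_assoc]
    _ ≤ (∑ x, p x ^ 2) * ∑ x, (∑ y, q y * ipChar x y) ^ 2 :=
        Finset.sum_mul_sq_le_sq_mul_sq _ _ _
    _ = _ := by rw [hq]; ring

/-- The points of `X` that agree with `α` on the coordinates in `I`. -/
def agreeOn {n b : ℕ} (X : Finset (Fin n → Fin b → Bool)) (I : Finset (Fin n))
    (α : Fin n → Fin b → Bool) : Finset (Fin n → Fin b → Bool) :=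
  X.filter fun x => ∀ i ∈ I, x i = α i

lemma agreeOn_agreeOn {n b : ℕ} (X : Finset (Fin n → Fin b → Bool)) {I S : Finset (Fin n)}
    (h : Disjoint I S) (α α' : Fin n → Fin b → Bool) :
    agreeOn (agreeOn X I α) S α' = agreeOn X (I ∪ S) (I.piecewise α α') := by
  ext x
  simp only [agreeOn, Finset.mem_filter, Finset.mem_union, and_assoc]
  refine and_congr_right fun _ => ⟨?_, fun hx => ⟨fun i hi => ?_, fun i hi => ?_⟩⟩
  · rintro ⟨h1, h2⟩ i hi
    by_cases hI : i ∈ I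
    · simp [hI, h1 i hI]
    · simp [hI, h2 i (hi.resolve_left hI)]
  · simpa [hi] using hx i (Or.inl hi)
  · have hI : i ∉ I := fun hI => Finset.disjoint_left.mp h hI hi
    simpa [hI] using hx i (Or.inr hi)

lemma card_agreeOn_mul_le {n b : ℕ} (X : Finset (Fin n → Fin b → Bool)) (I : Finset (Fin n))
    (α : Fin n → Fin b → Bool) : (agreeOn X I α).card * (2 ^ b) ^ I.card ≤ (2 ^ b) ^ n := by
  have hsub : agreeOn X I α ⊆
      Fintype.piFinset fun i => if i ∈ I then {α i} else Finset.univ := by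
    intro x hx
    rw [Fintype.mem_piFinset]
    intro i
    split_ifs with hi
    · simpa using (Finset.mem_filter.mp hx).2 i hi
    · simp
  have hcard : (Fintype.piFinset fun i => if i ∈ I then {α i} else Finset.univ).card
      = (2 ^ b) ^ (Iᶜ).card := by
    rw [Fintype.card_piFinset, ← Finset.prod_const, ← Finset.prod_mul_prod_compl I]
    rw [Finset.prod_congr rfl (g := fun _ => 1) fun i hi => by simp [hi], Finset.prod_const_one,
      one_mul]
    exact Finset.prod_congr rfl fun i hi => by simp [Finset.mem_compl.mp hi]
  calc _ ≤ (2 ^ b) ^ (Iᶜ).card * (2 ^ b) ^ I.card :=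
        Nat.mul_le_mul_right _ (hcard ▸ Finset.card_le_card hsub)
    _ = (2 ^ b) ^ n := by rw [← pow_add, Finset.card_compl_add_card, Fintype.card_fin]

/-- The unnormalized Fourier coefficient at `S` of the distribution of `gⁿ` on `X × Y`. -/
def fourierSum {n b : ℕ} (X Y : Finset (Fin n → Fin b → Bool)) (S : Finset (Fin n)) : ℝ :=
  ∑ x ∈ X, ∑ y ∈ Y, ∏ i ∈ S, bitSign (IP b (x i) (y i))

lemma sq_fourierSum_le {n b : ℕ} (X Y : Finset (Fin n → Fin b → Bool)) (S : Finset (Fin n))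
    {M : ℝ} (hM : ∀ α β, ((agreeOn X S α).card * (agreeOn Y S β).card : ℝ) ≤ M) :
    fourierSum X Y S ^ 2 ≤ ((2 : ℝ) ^ b) ^ S.card * (M * (X.card * Y.card)) := by
  let p (X : Finset (Fin n → Fin b → Bool)) (a : S → Fin b → Bool) : ℝ :=
    (X.filter fun x => S.restrict x = a).card
  have hp : ∀ (X : Finset (Fin n → Fin b → Bool)) (f : (S → Fin b → Bool) → ℝ),
      ∑ x ∈ X, f (S.restrict x) = ∑ a, p X a * f a := by
    intro X f
    rw [← Finset.sum_fiberwise X (fun x => S.restrict x)]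
    refine Finset.sum_congr rfl fun a _ => ?_
    rw [Finset.sum_congr rfl (g := fun _ => f a) fun x hx => by rw [(Finset.mem_filter.mp hx).2],
      Finset.sum_const, nsmul_eq_mul]
  have hp1 : ∀ X : Finset (Fin n → Fin b → Bool), ∑ a, p X a = X.card := by
    intro X
    simpa using (hp X fun _ => 1).symm
  have hF : fourierSum X Y S = ∑ a, ∑ c, p X a * p Y c * ipChar a c := by
    have h1 : fourierSum X Y S =
        ∑ x ∈ X, ∑ y ∈ Y, ipChar (S.restrict x) (S.restrict y) := by
      refine Finset.sum_congr rfl fun x _ => Finset.sum_congr rfl fun y _ => ?_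
      exact (Finset.prod_coe_sort S fun i => bitSign (IP b (x i) (y i))).symm
    rw [h1, hp X fun a => ∑ y ∈ Y, ipChar a (S.restrict y)]
    refine Finset.sum_congr rfl fun a _ => ?_
    rw [hp Y fun c => ipChar a c, Finset.mul_sum]
    exact Finset.sum_congr rfl fun c _ => by ring
  have hext : ∀ (X : Finset (Fin n → Fin b → Bool)) (a : S → Fin b → Bool),
      ∃ α, p X a = (agreeOn X S α).card := by
    intro X a
    refine ⟨fun i => if h : i ∈ S then a ⟨i, h⟩ else fun _ => false, ?_⟩
    simp only [p, agreeOn, funext_iff (g := a), Subtype.forall]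
    congr 1
    refine congrArg Finset.card (Finset.filter_congr fun x _ => forall₂_congr fun i hi => ?_)
    simp [hi]
  have hpq : ∀ a c, p X a * p Y c ≤ M := by
    intro a c
    obtain ⟨α, hα⟩ := hext X a
    obtain ⟨β, hβ⟩ := hext Y c
    rw [hα, hβ]
    exact hM α β
  rw [hF]
  refine (sq_sum_mul_ipChar_le _ _).trans ?_
  rw [Fintype.card_coe]
  refine mul_le_mul_of_nonneg_left ?_ (by positivity)
  rw [← hp1 X, ← hp1 Y, Finset.sum_mul_sum, Finset.sum_mul_sum, Finset.mul_sum]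
  refine Finset.sum_le_sum fun a _ => ?_
  rw [Finset.mul_sum]
  refine Finset.sum_le_sum fun c _ => ?_
  have h0 : 0 ≤ p X a * p Y c := by positivity
  nlinarith [mul_le_mul_of_nonneg_right (hpq a c) h0]

/-- If no restriction of `X × Y` to coordinates outside `I` is too dense, then `gⁿ` takes every
value outside `I` on `X × Y`. -/
lemma exists_gpow_eq_off {n b : ℕ} (X Y : Finset (Fin n → Fin b → Bool)) (I : Finset (Fin n))
    {r : ℝ} (hr : r ^ 4 = 2 ^ b) (hnr : 2 * (n : ℝ) ≤ r) (hr0 : 0 < r)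
    (hpos : 0 < (X.card * Y.card : ℝ))
    (hmax : ∀ S, Disjoint I S → ∀ α β,
      ((agreeOn X S α).card * (agreeOn Y S β).card : ℝ) * r ^ (6 * S.card) ≤ X.card * Y.card)
    (z : Fin n → Bool) :
    ∃ x ∈ X, ∃ y ∈ Y, ∀ i ∉ I, IP b (x i) (y i) = z i := by
  by_contra! hcon
  have hF : ∀ S, Disjoint I S → |fourierSum X Y S| ≤ X.card * Y.card * r⁻¹ ^ S.card := by
    intro S hS
    have h := sq_fourierSum_le X Y S (M := X.card * Y.card / r ^ (6 * S.card))
      fun α β => (le_div_iff₀ (by positivity)).mpr (hmax S hS α β)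
    refine abs_le_of_sq_le_sq (h.trans (le_of_eq ?_)) (by positivity)
    rw [← hr, inv_pow]
    field_simp
    ring
  have hT : ∑ x ∈ X, ∑ y ∈ Y, ∏ i ∈ Iᶜ, (1 + bitSign (z i) * bitSign (IP b (x i) (y i))) = 0 := by
    refine Finset.sum_eq_zero fun x hx => Finset.sum_eq_zero fun y hy => ?_
    obtain ⟨i, hi, hne⟩ := hcon x hx y hy
    refine Finset.prod_eq_zero (Finset.mem_compl.mpr hi) ?_
    revert hne
    cases IP b (x i) (y i) <;> cases z i <;> simp [bitSign]
  have hexp : ∑ x ∈ X, ∑ y ∈ Y, ∏ i ∈ Iᶜ, (1 + bitSign (z i) * bitSign (IP b (x i) (y i)))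
      = ∑ S ∈ (Iᶜ).powerset, (∏ i ∈ S, bitSign (z i)) * fourierSum X Y S := by
    simp only [Finset.prod_one_add, Finset.prod_mul_distrib, fourierSum, Finset.mul_sum]
    rw [Finset.sum_comm (s := (Iᶜ).powerset)]
    exact Finset.sum_congr rfl fun x _ => Finset.sum_comm
  have hempty : fourierSum X Y ∅ = X.card * Y.card := by simp [fourierSum]
  have hrest : |∑ S ∈ (Iᶜ).powerset.erase ∅, (∏ i ∈ S, bitSign (z i)) * fourierSum X Y S| ≤
      ∑ S ∈ (Iᶜ).powerset.erase ∅, X.card * Y.card * r⁻¹ ^ S.card := by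
    refine (Finset.abs_sum_le_sum_abs _ _).trans (Finset.sum_le_sum fun S hS => ?_)
    rw [abs_mul, Finset.abs_prod, Finset.prod_congr rfl fun i _ => abs_bitSign (z i),
      Finset.prod_const_one, one_mul]
    refine hF S ?_
    have := Finset.mem_powerset.mp (Finset.mem_of_mem_erase hS)
    exact (Finset.disjoint_left.mpr fun i hi hiS => Finset.mem_compl.mp (this hiS) hi)
  have hsum : ∑ S ∈ (Iᶜ).powerset, (X.card * Y.card : ℝ) * r⁻¹ ^ S.card
      = X.card * Y.card * (1 + r⁻¹) ^ (Iᶜ).card := by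
    rw [← Finset.mul_sum, ← Finset.prod_const, Finset.prod_one_add]
    simp
  have hlt : (1 + r⁻¹) ^ (Iᶜ).card < 2 := by
    calc (1 + r⁻¹) ^ (Iᶜ).card ≤ (1 + r⁻¹) ^ n := by
          refine pow_le_pow_right₀ (by linarith [inv_pos.mpr hr0]) ?_
          simpa using Finset.card_le_univ (Iᶜ)
      _ ≤ Real.exp (r⁻¹) ^ n := by
          refine pow_le_pow_left₀ (by positivity) ?_ n
          linarith [Real.add_one_le_exp r⁻¹]
      _ = Real.exp (n * r⁻¹) := (Real.exp_nat_mul _ _).symm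
      _ ≤ Real.exp (1 / 2) := by
          refine Real.exp_le_exp.mpr ?_
          rw [← div_eq_mul_inv, div_le_iff₀ hr0]
          linarith
      _ < 2 := by
          rw [← Real.lt_log_iff_exp_lt (by norm_num)]
          linarith [Real.log_two_gt_d9]
  have hmem : ∅ ∈ (Iᶜ).powerset := Finset.empty_mem_powerset _
  rw [hexp, ← Finset.add_sum_erase _ _ hmem, hempty] at hT
  rw [← Finset.add_sum_erase _ _ hmem] at hsum
  simp only [Finset.prod_empty, one_mul, Finset.card_empty, pow_zero, mul_one] at hT hsum
  have := (abs_le.mp hrest).1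
  nlinarith

/-- A rectangle of large density maps onto a subcube of small codimension. -/
lemma exists_subcube_of_dense {n b : ℕ} (X Y : Finset (Fin n → Fin b → Bool))
    {r : ℝ} (hr : r ^ 4 = 2 ^ b) (hnr : 2 * (n : ℝ) ≤ r) (hr0 : 0 < r)
    (hpos : 0 < (X.card * Y.card : ℝ)) :
    ∃ (I : Finset (Fin n)) (ρ : Fin n → Bool),
      (X.card * Y.card : ℝ) * r ^ (2 * I.card) ≤ r ^ (8 * n) ∧
      ∀ z : Fin n → Bool, (∀ i ∈ I, z i = ρ i) →
        ∃ x ∈ X, ∃ y ∈ Y, gpow (IP b) x y = z := by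
  let Φ (t : Finset (Fin n) × (Fin n → Fin b → Bool) × (Fin n → Fin b → Bool)) : ℝ :=
    ((agreeOn X t.1 t.2.1).card * (agreeOn Y t.1 t.2.2).card : ℝ) * r ^ (6 * t.1.card)
  obtain ⟨⟨I, α, β⟩, hmax⟩ := Finite.exists_max Φ
  have hbase : (X.card * Y.card : ℝ) ≤ Φ (I, α, β) := by
    have := hmax (∅, α, β)
    simpa [Φ, agreeOn] using this
  refine ⟨I, gpow (IP b) α β, ?_, ?_⟩
  · have hc : ∀ (X : Finset (Fin n → Fin b → Bool)) α,
        ((agreeOn X I α).card : ℝ) * r ^ (4 * I.card) ≤ r ^ (4 * n) := by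
      intro X α
      rw [pow_mul, pow_mul, hr]
      exact_mod_cast card_agreeOn_mul_le X I α
    calc (X.card * Y.card : ℝ) * r ^ (2 * I.card) ≤ Φ (I, α, β) * r ^ (2 * I.card) := by gcongr
      _ = ((agreeOn X I α).card * r ^ (4 * I.card)) * ((agreeOn Y I β).card * r ^ (4 * I.card)) := by
          simp only [Φ]; ring
      _ ≤ r ^ (4 * n) * r ^ (4 * n) :=
          mul_le_mul (hc X α) (hc Y β) (by positivity) (by positivity)
      _ = r ^ (8 * n) := by ring
  · intro z hz
    have hpos' : 0 < ((agreeOn X I α).card * (agreeOn Y I β).card : ℝ) := by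
      have h : 0 < Φ (I, α, β) := hpos.trans_le hbase
      exact pos_of_mul_pos_left h (by positivity)
    obtain ⟨x, hx, y, hy, hxy⟩ := exists_gpow_eq_off (agreeOn X I α) (agreeOn Y I β) I hr hnr hr0
      hpos' (fun S hS α' β' => by
        have h := hmax (I ∪ S, I.piecewise α α', I.piecewise β β')
        simp only [Φ] at h
        rw [← agreeOn_agreeOn X hS, ← agreeOn_agreeOn Y hS, Finset.card_union_of_disjoint hS,
          mul_add, pow_add, mul_comm (r ^ (6 * I.card)), ← mul_assoc] at h
        exact le_of_mul_le_mul_right h (by positivity)) z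
    obtain ⟨hxX, hxα⟩ := Finset.mem_filter.mp hx
    obtain ⟨hyY, hyβ⟩ := Finset.mem_filter.mp hy
    refine ⟨x, hxX, y, hyY, funext fun i => ?_⟩
    by_cases hi : i ∈ I
    · rw [hz i hi, gpow, gpow, hxα i hi, hyβ i hi]
    · exact hxy i hi

/-- The number of `v` with `⟨u, v⟩ = t`. -/
def ipFiber {b : ℕ} (t : Bool) (u : Fin b → Bool) : ℕ :=
  (Finset.univ.filter fun v => IP b u v = t).card

lemma ipFiber_eq {b : ℕ} (t : Bool) (u : Fin b → Bool) :
    (ipFiber t u : ℝ) = (2 ^ b + bitSign t * if u = (fun _ => false) then 2 ^ b else 0) / 2 := by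
  have h0 : ∀ v : Fin b → Bool, IP b v (fun _ => false) = false := by simp [IP]
  have h1 : ∑ v, bitSign (IP b u v) = if u = (fun _ => false) then (2 : ℝ) ^ b else 0 := by
    rw [← sum_bitSign_IP_mul]
    refine Finset.sum_congr rfl fun v _ => ?_
    rw [h0, IP_comm u v]
    simp [bitSign]
  rw [← h1, Finset.mul_sum]
  have h2 : ((2 : ℝ) ^ b) = ∑ _v : Fin b → Bool, 1 := by simp
  rw [h2, ← Finset.sum_add_distrib, ipFiber, Finset.card_filter, Finset.sum_div]
  push_cast
  refine Finset.sum_congr rfl fun v _ => ?_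
  cases IP b u v <;> cases t <;> norm_num [bitSign]

lemma sum_ipFiber_ge {b : ℕ} (t : Bool) :
    (2 : ℝ) ^ b * (2 ^ b - 1) / 2 ≤ ∑ u : Fin b → Bool, (ipFiber t u : ℝ) := by
  simp only [ipFiber_eq]
  rw [← Finset.sum_div, Finset.sum_add_distrib, ← Finset.mul_sum, Finset.sum_ite_eq']
  have : (0 : ℝ) < 2 ^ b := by positivity
  cases t <;> simp [bitSign] <;> nlinarith

lemma sum_sq_ipFiber_le {b : ℕ} (t : Bool) :
    ∑ u : Fin b → Bool, (ipFiber t u : ℝ) ^ 2 ≤ ((2 : ℝ) ^ b) ^ 2 * (2 ^ b + 3) / 4 := by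
  have h : ∀ u : Fin b → Bool, (ipFiber t u : ℝ) ^ 2 ≤
      (((2 : ℝ) ^ b) ^ 2 + if u = (fun _ => false) then 3 * ((2 : ℝ) ^ b) ^ 2 else 0) / 4 := by
    intro u
    rw [ipFiber_eq]
    have : (0 : ℝ) < 2 ^ b := by positivity
    split_ifs <;> cases t <;> simp only [bitSign] <;> norm_num <;> nlinarith
  refine (Finset.sum_le_sum fun u _ => h u).trans (le_of_eq ?_)
  rw [← Finset.sum_div, Finset.sum_add_distrib, Finset.sum_ite_eq']
  simp
  ring

lemma card_gpow_fiber {n b : ℕ} (z : Fin n → Bool) (x : Fin n → Fin b → Bool) :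
    (Finset.univ.filter fun y => gpow (IP b) x y = z).card = ∏ i, ipFiber (z i) (x i) := by
  simp only [ipFiber]
  rw [← Fintype.card_piFinset]
  congr 1
  ext y
  simp [gpow, funext_iff]

lemma card_gpow_preimage {n b : ℕ} (z : Fin n → Bool) (X Y : Finset (Fin n → Fin b → Bool)) :
    ((X ×ˢ Y).filter fun p => gpow (IP b) p.1 p.2 = z).card =
      ∑ x ∈ X, (Y.filter fun y => gpow (IP b) x y = z).card := by
  simp only [Finset.card_filter, Finset.sum_product]

lemma card_gpow_preimage_univ_ge {n b : ℕ} (z : Fin n → Bool) :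
    ((2 : ℝ) ^ b * (2 ^ b - 1) / 2) ^ n ≤
      ((Finset.univ.filter fun p : (Fin n → Fin b → Bool) × (Fin n → Fin b → Bool) =>
        gpow (IP b) p.1 p.2 = z).card : ℝ) := by
  rw [← Finset.univ_product_univ, card_gpow_preimage]
  simp only [card_gpow_fiber]
  push_cast
  rw [← Fintype.prod_sum (fun i u => (ipFiber (b := b) (z i) u : ℝ))]
  have h1 : (1 : ℝ) ≤ 2 ^ b := one_le_pow₀ (by norm_num)
  calc _ = ∏ _i : Fin n, ((2 : ℝ) ^ b * (2 ^ b - 1) / 2) := by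
        rw [Finset.prod_const, Finset.card_univ, Fintype.card_fin]
    _ ≤ _ := Finset.prod_le_prod
        (fun i _ => div_nonneg (mul_nonneg (by positivity) (by linarith)) (by norm_num))
        fun i _ => sum_ipFiber_ge (z i)

lemma sq_card_gpow_preimage_le {n b : ℕ} (z : Fin n → Bool)
    (X Y : Finset (Fin n → Fin b → Bool)) :
    (((X ×ˢ Y).filter fun p => gpow (IP b) p.1 p.2 = z).card : ℝ) ^ 2 ≤
      X.card * (((2 : ℝ) ^ b) ^ 2 * (2 ^ b + 3) / 4) ^ n := by
  have h1 : (((X ×ˢ Y).filter fun p => gpow (IP b) p.1 p.2 = z).card : ℝ) ≤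
      ∑ x ∈ X, ∏ i, (ipFiber (z i) (x i) : ℝ) := by
    rw [card_gpow_preimage]
    push_cast
    refine Finset.sum_le_sum fun x _ => ?_
    rw [← Nat.cast_prod, ← card_gpow_fiber]
    exact_mod_cast Finset.card_le_card (Finset.filter_subset_filter _ (Finset.subset_univ Y))
  calc _ ≤ (∑ x ∈ X, ∏ i, (ipFiber (z i) (x i) : ℝ)) ^ 2 := by gcongr
    _ ≤ X.card * ∑ x ∈ X, (∏ i, (ipFiber (z i) (x i) : ℝ)) ^ 2 := sq_sum_le_card_mul_sum_sq
    _ ≤ X.card * ∑ x : Fin n → Fin b → Bool, (∏ i, (ipFiber (z i) (x i) : ℝ)) ^ 2 := by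
        refine mul_le_mul_of_nonneg_left ?_ (by positivity)
        exact Finset.sum_le_sum_of_subset_of_nonneg (Finset.subset_univ X)
          fun x _ _ => sq_nonneg _
    _ = X.card * ∏ i, ∑ u : Fin b → Bool, (ipFiber (z i) u : ℝ) ^ 2 := by
        simp only [← Finset.prod_pow]
        rw [← Fintype.prod_sum (fun i u => (ipFiber (b := b) (z i) u : ℝ) ^ 2)]
    _ ≤ X.card * ∏ _i : Fin n, (((2 : ℝ) ^ b) ^ 2 * (2 ^ b + 3) / 4) := by
        gcongr with i _
        exact sum_sq_ipFiber_le (z i)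
    _ = _ := by rw [Finset.prod_const, Finset.card_univ, Fintype.card_fin]

/-- A rectangle with a `δ` fraction of a fibre of `gⁿ` has rows of density at least `δ² / 2`. -/
lemma card_rows_ge {n b : ℕ} (hb : 10 * (n : ℝ) ≤ 2 ^ b) (hb' : (5 : ℝ) ≤ 2 ^ b)
    (z : Fin n → Bool) (X Y : Finset (Fin n → Fin b → Bool)) {δ : ℝ} (hδ : 0 ≤ δ)
    (h : δ * ((Finset.univ.filter fun p : (Fin n → Fin b → Bool) × (Fin n → Fin b → Bool) =>
        gpow (IP b) p.1 p.2 = z).card : ℝ) ≤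
      (((X ×ˢ Y).filter fun p => gpow (IP b) p.1 p.2 = z).card : ℝ)) :
    δ ^ 2 / 2 * ((2 : ℝ) ^ b) ^ n ≤ X.card := by
  have hlow := card_gpow_preimage_univ_ge (b := b) z
  have hup := sq_card_gpow_preimage_le z X Y
  set N : ℝ := 2 ^ b with hN
  have hA : 0 ≤ N * (N - 1) / 2 := by nlinarith
  have hB : 0 < N ^ 2 * (N + 3) / 4 := by positivity
  have h1 : (δ * (N * (N - 1) / 2) ^ n) ^ 2 ≤ X.card * (N ^ 2 * (N + 3) / 4) ^ n := by
    refine le_trans ?_ hup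
    exact pow_le_pow_left₀ (by positivity) ((mul_le_mul_of_nonneg_left hlow hδ).trans h) 2
  have h2 : (N ^ 2 * (N + 3) / 4) ^ n * (N - 5) ^ n ≤ ((N * (N - 1) / 2) ^ n) ^ 2 := by
    rw [← mul_pow, pow_right_comm (N * (N - 1) / 2)]
    refine pow_le_pow_left₀ (mul_nonneg hB.le (by linarith)) ?_ n
    nlinarith [sq_nonneg N]
  have h3 : N ^ n / 2 ≤ (N - 5) ^ n := by
    have hN0 : 0 < N := by linarith
    have hbern := one_add_mul_le_pow (a := -(5 / N)) (by
      rw [neg_le_neg_iff, div_le_iff₀ hN0]; linarith) n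
    have h5 : n * (5 / N) ≤ 1 / 2 := by
      rw [mul_div_assoc', div_le_iff₀ hN0]; linarith
    have heq : (N - 5) ^ n = N ^ n * (1 + -(5 / N)) ^ n := by
      rw [← mul_pow]
      congr 1
      field_simp
      ring
    rw [heq]
    have : 0 < N ^ n := by positivity
    nlinarith
  have h4 : δ ^ 2 * (N - 5) ^ n ≤ X.card := by
    refine le_of_mul_le_mul_right ?_ (pow_pos hB n)
    calc _ = δ ^ 2 * ((N ^ 2 * (N + 3) / 4) ^ n * (N - 5) ^ n) := by ring
      _ ≤ δ ^ 2 * ((N * (N - 1) / 2) ^ n) ^ 2 := by gcongr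
      _ = (δ * (N * (N - 1) / 2) ^ n) ^ 2 := by ring
      _ ≤ _ := h1
  nlinarith [mul_le_mul_of_nonneg_left h3 (sq_nonneg δ)]

lemma card_gpow_preimage_swap {n b : ℕ} (z : Fin n → Bool)
    (X Y : Finset (Fin n → Fin b → Bool)) :
    ((Y ×ˢ X).filter fun p => gpow (IP b) p.1 p.2 = z).card =
      ((X ×ˢ Y).filter fun p => gpow (IP b) p.1 p.2 = z).card := by
  refine Finset.card_equiv (Equiv.prodComm _ _) fun p => ?_
  have : gpow (IP b) p.1 p.2 = gpow (IP b) p.2 p.1 := funext fun i => IP_comm _ _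
  simp [this, and_comm]

lemma rpow_bOf_ge {n : ℕ} (hn : 2 ≤ n) :
    100 ≤ bOf n ∧ 10 * (n : ℝ) ≤ (2 : ℝ) ^ ((bOf n : ℝ) / 4) := by
  have hn' : (2 : ℝ) ≤ n := by exact_mod_cast hn
  have hb : 100 * Real.logb 2 n ≤ bOf n := Nat.le_ceil _
  have hlog : 1 ≤ Real.logb 2 n := by
    rw [Real.le_logb_iff_rpow_le (by norm_num) (by linarith)]
    simpa using hn'
  refine ⟨by exact_mod_cast (show (100 : ℝ) ≤ bOf n by linarith), ?_⟩
  calc 10 * (n : ℝ) ≤ 2 ^ 24 * n := by gcongr; norm_num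
    _ ≤ (n : ℝ) ^ 24 * n := by gcongr
    _ = ((2 : ℝ) ^ Real.logb 2 n) ^ (25 : ℕ) := by
        rw [Real.rpow_logb (by norm_num) (by norm_num) (by linarith)]; ring
    _ = (2 : ℝ) ^ (Real.logb 2 n * 25) := by
        rw [← Real.rpow_natCast, ← Real.rpow_mul (by norm_num)]; norm_num
    _ ≤ (2 : ℝ) ^ ((bOf n : ℝ) / 4) :=
        Real.rpow_le_rpow_of_exponent_le (by norm_num) (by linarith)

/-- There is a constant `K` such that for all sufficiently large `n`:
for every rectangle `X × Y`, every `z`, and every `c ≥ 0`, if `X × Y` contains at least a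
`2^{-c}` fraction of `W z`, then some subcube of codimension at most `K·c/b(n)` is
contained in `gⁿ(X × Y)`. -/
theorem confounding_lemma :
    ∃ K : ℝ, 0 < K ∧ ∃ N : ℕ, ∀ n : ℕ, N ≤ n →
      ∀ (X Y : Finset (Fin n → Fin (bOf n) → Bool)) (z : Fin n → Bool) (c : ℝ), 0 ≤ c →
        (2 : ℝ) ^ (-c) * ((Wset n z).card : ℝ) ≤
          (((X ×ˢ Y).filter fun p => gpow (IP (bOf n)) p.1 p.2 = z).card : ℝ) →
        ∃ (I : Finset (Fin n)) (ρ : Fin n → Bool),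
          (I.card : ℝ) ≤ K * c / (bOf n) ∧
          ∀ z' : Fin n → Bool, (∀ i ∈ I, z' i = ρ i) →
            ∃ x ∈ X, ∃ y ∈ Y, gpow (IP (bOf n)) x y = z' := by
  refine ⟨16, by norm_num, 2, fun n hn X Y z c hc h => ?_⟩
  obtain ⟨hb, hnr⟩ := rpow_bOf_ge hn
  unfold Wset at h
  generalize bOf n = b at *
  have hbR : (100 : ℝ) ≤ b := by exact_mod_cast hb
  set r : ℝ := 2 ^ ((b : ℝ) / 4) with hrdef
  have hr : r ^ 4 = 2 ^ b := by
    rw [hrdef, ← Real.rpow_natCast, ← Real.rpow_mul (by norm_num), ← Real.rpow_natCast]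
    congr 1
    push_cast
    ring
  have hn0 : (2 : ℝ) ≤ n := by exact_mod_cast hn
  have hr1 : 1 ≤ r := by linarith
  have hN : 10 * (n : ℝ) ≤ 2 ^ b := hr ▸ hnr.trans (le_self_pow₀ hr1 (by norm_num))
  have hX := card_rows_ge hN (by linarith) z X Y (by positivity) h
  have hY := card_rows_ge hN (by linarith) z Y X (by positivity)
    (h.trans_eq (by rw [card_gpow_preimage_swap]))
  have hXY := mul_le_mul hX hY (by positivity) (by positivity)
  obtain ⟨I, ρ, hI, hcube⟩ := exists_subcube_of_dense X Y hr (by linarith) (by linarith)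
    (lt_of_lt_of_le (by positivity) hXY)
  refine ⟨I, ρ, ?_, hcube⟩
  have hpow : ((2 : ℝ) ^ (-c)) ^ 4 / 4 * r ^ (2 * I.card) ≤ 1 := by
    have h8 : 0 < r ^ (8 * n) := by positivity
    refine le_of_mul_le_mul_right ?_ h8
    calc _ = ((2 : ℝ) ^ (-c)) ^ 2 / 2 * (r ^ 4) ^ n * (((2 : ℝ) ^ (-c)) ^ 2 / 2 * (r ^ 4) ^ n)
          * r ^ (2 * I.card) := by ring
      _ ≤ X.card * Y.card * r ^ (2 * I.card) := by rw [hr]; gcongr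
      _ ≤ 1 * r ^ (8 * n) := by rw [one_mul]; exact hI
  have hexp : (b : ℝ) * I.card / 2 ≤ 4 * c + 2 := by
    have heq : ((2 : ℝ) ^ (-c)) ^ 4 / 4 * r ^ (2 * I.card) =
        (2 : ℝ) ^ ((b : ℝ) * I.card / 2 - (4 * c + 2)) := by
      have h4 : ∀ t : ℝ, t / 4 = t / (2 : ℝ) ^ (2 : ℝ) := by norm_num
      rw [h4 (((2 : ℝ) ^ (-c)) ^ 4), hrdef, ← Real.rpow_natCast, ← Real.rpow_natCast,
        ← Real.rpow_mul (by norm_num), ← Real.rpow_mul (by norm_num)]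
      rw [← Real.rpow_sub (by norm_num), ← Real.rpow_add (by norm_num)]
      congr 1
      push_cast
      ring
    rw [heq, Real.rpow_le_one_iff_of_pos (by norm_num)] at hpow
    rcases hpow with hp | hp
    · linarith
    · norm_num at hp
  rw [le_div_iff₀ (by linarith)]
  rcases Nat.eq_zero_or_pos I.card with h0 | h0
  · rw [h0]
    push_cast
    linarith
  · have h1 : (1 : ℝ) ≤ I.card := by exact_mod_cast h0
    nlinarith
end

section
/- For all total 0-1 matrices M and N: max{ rank₊(M)·fool(N), fool(M)·rank₊(N) } ≤ rank₊(M ⊗ N) ≤ rank₊(M)·rank₊(N), where M ⊗ N is the Kronecker (tensor) product. -/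
/-- `M` is a total 0-1 matrix: every entry is `0` or `1`. -/
def Is01 {α β : Type*} (M : Matrix α β ℝ) : Prop :=
  ∀ i j, M i j = 0 ∨ M i j = 1

/-- `M` is a sum of `r` entrywise-nonnegative rank-at-most-1 real matrices,
the `k`-th summand being the outer product of the nonnegative vectors `u k` and `v k`. -/
def NNDecomp {α β : Type*} (M : Matrix α β ℝ) (r : ℕ) : Prop :=
  ∃ (u : Fin r → α → ℝ) (v : Fin r → β → ℝ),
    (∀ k i, 0 ≤ u k i) ∧ (∀ k j, 0 ≤ v k j) ∧
    ∀ i j, M i j = ∑ k, u k i * v k j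

/-- The nonnegative rank `rank₊(M)`: the smallest `r` such that `M` is a sum of `r`
entrywise-nonnegative rank-at-most-1 real matrices. -/
noncomputable def nnRank {α β : Type*} (M : Matrix α β ℝ) : ℕ :=
  sInf {r | NNDecomp M r}

/-- `M` is a sum of `r` rank-at-most-1 matrices all of whose entries are in `{0,1}`,
the `k`-th summand being the outer product of the 0-1 vectors `u k` and `v k`. -/
def BinDecomp {α β : Type*} (M : Matrix α β ℝ) (r : ℕ) : Prop :=
  ∃ (u : Fin r → α → ℝ) (v : Fin r → β → ℝ),
    (∀ k i, u k i = 0 ∨ u k i = 1) ∧ (∀ k j, v k j = 0 ∨ v k j = 1) ∧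
    ∀ i j, M i j = ∑ k, u k i * v k j

/-- The binary rank `rank₀₁(M)`: the smallest `r` such that `M` is a sum of `r`
rank-at-most-1 matrices with entries in `{0,1}`. -/
noncomputable def binRank {α β : Type*} (M : Matrix α β ℝ) : ℕ :=
  sInf {r | BinDecomp M r}

/-- A fooling set of `M`: a set of positions of 1-entries such that for any two distinct
positions `(a,b)` and `(c,d)` in it, `M a d = 0` or `M c b = 0`. -/
def IsFoolingSet {α β : Type*} (M : Matrix α β ℝ) (S : Finset (α × β)) : Prop :=
  (∀ p ∈ S, M p.1 p.2 = 1) ∧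
  ∀ p ∈ S, ∀ q ∈ S, p ≠ q → M p.1 q.2 = 0 ∨ M q.1 p.2 = 0

/-- `fool M` is the maximum size of a fooling set of `M`. -/
noncomputable def fool {α β : Type*} (M : Matrix α β ℝ) : ℕ :=
  sSup {s | ∃ S : Finset (α × β), IsFoolingSet M S ∧ S.card = s}

theorem NNDecomp.of_fintype {α β ι : Type*} [Fintype ι] {M : Matrix α β ℝ}
    (u : ι → α → ℝ) (v : ι → β → ℝ) (hu : ∀ k i, 0 ≤ u k i) (hv : ∀ k j, 0 ≤ v k j)
    (h : ∀ i j, M i j = ∑ k, u k i * v k j) : NNDecomp M (Fintype.card ι) := by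
  let e := (Fintype.equivFin ι).symm
  refine ⟨fun k => u (e k), fun k => v (e k), fun k => hu _, fun k => hv _, fun i j => ?_⟩
  rw [h i j]
  exact (e.sum_comp fun k => u k i * v k j).symm

theorem nnDecomp_card_of_nonneg {α β : Type*} [Fintype α] {M : Matrix α β ℝ}
    (hM : ∀ i j, 0 ≤ M i j) : NNDecomp M (Fintype.card α) := by
  classical
  refine NNDecomp.of_fintype (fun k i => if k = i then 1 else 0) M (fun k i => ?_) hM ?_
  · split_ifs <;> norm_num
  · simp

theorem NNDecomp.nnRank_le {α β : Type*} {M : Matrix α β ℝ} {r : ℕ} (h : NNDecomp M r) :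
    nnRank M ≤ r :=
  Nat.sInf_le h

theorem nnDecomp_nnRank {α β : Type*} [Fintype α] {M : Matrix α β ℝ}
    (hM : ∀ i j, 0 ≤ M i j) : NNDecomp M (nnRank M) :=
  Nat.sInf_mem (s := {r | NNDecomp M r}) ⟨_, nnDecomp_card_of_nonneg hM⟩

theorem exists_isFoolingSet_card_eq_fool {α β : Type*} [Fintype α] [Fintype β]
    (M : Matrix α β ℝ) : ∃ S, IsFoolingSet M S ∧ S.card = fool M := by
  refine Nat.sSup_mem (s := {s | ∃ S : Finset (α × β), IsFoolingSet M S ∧ S.card = s})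
    ⟨0, ∅, by simp [IsFoolingSet], rfl⟩ ⟨Fintype.card (α × β), ?_⟩
  rintro _ ⟨S, -, rfl⟩
  exact S.card_le_univ

theorem Is01.nonneg {α β : Type*} {M : Matrix α β ℝ} (hM : Is01 M) (i : α) (j : β) :
    0 ≤ M i j := by
  rcases hM i j with h | h <;> simp [h]

/-- The summands of a decomposition of `M ⊗ N` that are not identically zero on the copies of `M`
at distinct positions of a fooling set of `N` are distinct. The entries of the product are accessed
through `f` and `g`, so that the lemma applies to both orders of the factors. -/
theorem NNDecomp.nnRank_mul_card_le {α β γ δ ρ σ : Type*} {M : Matrix α β ℝ} {N : Matrix γ δ ℝ}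
    {P : Matrix ρ σ ℝ} (f : α → γ → ρ) (g : β → δ → σ)
    (hP : ∀ i j a b, P (f i a) (g j b) = M i j * N a b) {r : ℕ} (h : NNDecomp P r)
    {S : Finset (γ × δ)} (hS : IsFoolingSet N S) : nnRank M * S.card ≤ r := by
  classical
  obtain ⟨u, v, hu, hv, huv⟩ := h
  let T : γ × δ → Finset (Fin r) := fun p =>
    {k | ∃ i j, u k (f i p.1) * v k (g j p.2) ≠ 0}
  have card_T : ∀ p ∈ S, nnRank M ≤ (T p).card := by
    intro p hp
    rw [← Fintype.card_coe]
    refine (NNDecomp.of_fintype (fun (k : T p) i => u k (f i p.1)) (fun k j => v k (g j p.2))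
      (fun _ _ => hu _ _) (fun _ _ => hv _ _) fun i j => ?_).nnRank_le
    rw [Finset.sum_coe_sort (T p) fun k => u k (f i p.1) * v k (g j p.2),
      Finset.sum_subset (Finset.subset_univ (T p)), ← huv, hP, hS.1 p hp, mul_one]
    intro k _ hk
    by_contra hne
    exact hk (Finset.mem_filter.2 ⟨Finset.mem_univ _, i, j, hne⟩)
  have ne_zero : ∀ k i a j b, u k (f i a) ≠ 0 → v k (g j b) ≠ 0 → N a b ≠ 0 := by
    intro k i a j b h₁ h₂ h₀
    have hsum := huv (f i a) (g j b)
    rw [hP, h₀, mul_zero, eq_comm,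
      Finset.sum_eq_zero_iff_of_nonneg fun k _ => mul_nonneg (hu _ _) (hv _ _)] at hsum
    exact mul_ne_zero h₁ h₂ (hsum k (Finset.mem_univ _))
  have disjoint_T : (S : Set (γ × δ)).PairwiseDisjoint T := by
    intro p hp q hq hpq
    refine Finset.disjoint_left.2 fun k hkp hkq => ?_
    obtain ⟨-, i, j, hij⟩ := Finset.mem_filter.1 hkp
    obtain ⟨-, i', j', hij'⟩ := Finset.mem_filter.1 hkq
    rcases hS.2 p hp q hq hpq with h₀ | h₀
    · exact ne_zero k _ _ _ _ (left_ne_zero_of_mul hij) (right_ne_zero_of_mul hij') h₀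
    · exact ne_zero k _ _ _ _ (left_ne_zero_of_mul hij') (right_ne_zero_of_mul hij) h₀
  calc nnRank M * S.card = ∑ _p ∈ S, nnRank M := by simp [mul_comm]
    _ ≤ ∑ p ∈ S, (T p).card := Finset.sum_le_sum card_T
    _ = (S.biUnion T).card := (Finset.card_biUnion disjoint_T).symm
    _ ≤ r := by simpa using (S.biUnion T).card_le_univ

theorem NNDecomp.kronecker {α β γ δ : Type*} {M : Matrix α β ℝ} {N : Matrix γ δ ℝ} {r s : ℕ}
    (hM : NNDecomp M r) (hN : NNDecomp N s) :
    NNDecomp (Matrix.kroneckerMap (· * ·) M N) (r * s) := by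
  obtain ⟨u, v, hu, hv, huv⟩ := hM
  obtain ⟨w, x, hw, hx, hwx⟩ := hN
  have h : NNDecomp (Matrix.kroneckerMap (· * ·) M N) (Fintype.card (Fin r × Fin s)) := by
    refine NNDecomp.of_fintype (fun k i => u k.1 i.1 * w k.2 i.2)
      (fun k j => v k.1 j.1 * x k.2 j.2) (fun _ _ => mul_nonneg (hu _ _) (hw _ _))
      (fun _ _ => mul_nonneg (hv _ _) (hx _ _)) fun i j => ?_
    rw [Matrix.kroneckerMap_apply, huv, hwx, Finset.sum_mul_sum, Fintype.sum_prod_type]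
    exact Finset.sum_congr rfl fun _ _ => Finset.sum_congr rfl fun _ _ =>
      mul_mul_mul_comm _ _ _ _
  simpa using h

/-- For all total 0-1 matrices `M` and `N`,
`max (rank₊(M)·fool(N), fool(M)·rank₊(N)) ≤ rank₊(M ⊗ N) ≤ rank₊(M)·rank₊(N)`. -/
theorem nnRank_kronecker (n₁ m₁ n₂ m₂ : ℕ)
    (M : Matrix (Fin n₁) (Fin m₁) ℝ) (N : Matrix (Fin n₂) (Fin m₂) ℝ)
    (hM : Is01 M) (hN : Is01 N) :
    max (nnRank M * fool N) (fool M * nnRank N) ≤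
        nnRank (Matrix.kroneckerMap (· * ·) M N) ∧
      nnRank (Matrix.kroneckerMap (· * ·) M N) ≤ nnRank M * nnRank N := by
  have hMN := (nnDecomp_nnRank hM.nonneg).kronecker (nnDecomp_nnRank hN.nonneg)
  have hP : NNDecomp (Matrix.kroneckerMap (· * ·) M N) (nnRank (Matrix.kroneckerMap (· * ·) M N)) :=
    nnDecomp_nnRank fun i j => mul_nonneg (hM.nonneg _ _) (hN.nonneg _ _)
  obtain ⟨S, hS, hS_card⟩ := exists_isFoolingSet_card_eq_fool M
  obtain ⟨T, hT, hT_card⟩ := exists_isFoolingSet_card_eq_fool N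
  refine ⟨max_le ?_ ?_, hMN.nnRank_le⟩
  · rw [← hT_card]
    exact hP.nnRank_mul_card_le (fun i a => (i, a)) (fun j b => (j, b)) (fun _ _ _ _ => rfl) hT
  · rw [← hS_card, mul_comm]
    exact hP.nnRank_mul_card_le (fun a i => (i, a)) (fun b j => (j, b))
      (fun _ _ _ _ => mul_comm _ _) hS
end
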